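/- Suppose there exists a constant C > 0 such that for every prime p ≡ 1 (mod 4) and every integer K with 2 ≤ K ≤ p + 1, the Paley ETF Φ_p has the (K, δ)-RIP with δ = C·√(K/p)·(log K)·(log p). Then for every α with 0 < α < 1/2 there exist β > 0 and p₀ such that for every prime p ≥ p₀ with p ≡ 1 (mod 4) the following holds: for any two independent sources X and Y on F_p, each with min-entropy at least α·n where n = ⌈log₂ p⌉, one has |Pr[Ext_p(X,Y) = 1] − 1/2| ≤ p^{−β}; that is, Ext_p is a 2-source (α·n, p^{−β})-extractor. -/

import Mathlib

open scoped Classical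
open Finset

noncomputable section

/-- The quadratic character `χ` of `F_p`: `χ 0 = 0`, `χ x = 1` if `x` is a nonzero square,
and `χ x = -1` otherwise. -/
def quadChar (p : ℕ) (x : ZMod p) : ℤ :=
  if x = 0 then 0 else if IsSquare x then 1 else -1

/-- The canonical additive character `ψ` of `F_p`, `ψ x = exp(2πi·x/p)`. -/
def addChar' (p : ℕ) (x : ZMod p) : ℂ :=
  Complex.exp (2 * Real.pi * Complex.I * (x.val : ℂ) / (p : ℂ))

/-- The set of quadratic residues mod `p` (nonzero squares), as a type. -/
abbrev QRes (p : ℕ) : Type := {b : ZMod p // b ≠ 0 ∧ IsSquare b}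

/-- The Paley ETF: rows indexed by `{0} ∪ Q_p` (with `none` the `0`-row),
columns indexed by `F_p ∪ {∞}` (with `none` the `∞`-column). -/
def PaleyETF (p : ℕ) : Matrix (Option (QRes p)) (Option (ZMod p)) ℂ :=
  fun r c =>
    match r, c with
    | none, none => 1
    | none, some _ => ((1 / Real.sqrt p : ℝ) : ℂ)
    | some _, none => 0
    | some b, some a => ((Real.sqrt (2 / p) : ℝ) : ℂ) * addChar' p (b.1 * a)

/-- `(K, δ)`-restricted isometry property for a complex matrix: for every vector `x`
with at most `K` nonzero entries, `(1-δ)‖x‖² ≤ ‖Φx‖² ≤ (1+δ)‖x‖²`. -/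
def HasRIP {M N : Type*} [Fintype M] [Fintype N] (Φ : Matrix M N ℂ) (K δ : ℝ) : Prop :=
  ∀ x : N → ℂ, ((Finset.univ.filter fun n => x n ≠ 0).card : ℝ) ≤ K →
    (1 - δ) * ∑ n, ‖x n‖ ^ 2 ≤ ∑ m, ‖∑ n, Φ m n * x n‖ ^ 2 ∧
      ∑ m, ‖∑ n, Φ m n * x n‖ ^ 2 ≤ (1 + δ) * ∑ n, ‖x n‖ ^ 2

/-- The Paley graph extractor: `Ext_p(x,y) = 1` if `x = y`, and `(χ(x−y)+1)/2` otherwise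
(which is `1` iff `x − y` is a nonzero square, `0` otherwise). -/
def paleyExt (p : ℕ) (x y : ZMod p) : ℕ :=
  if x = y then 1 else if IsSquare (x - y) then 1 else 0

/-- Indicator vector of `U ⊆ F_p` with respect to the column indexing of the Paley ETF
(entry `0` in the `∞` coordinate). -/
def indic (p : ℕ) (U : Finset (ZMod p)) : Option (ZMod p) → ℂ :=
  fun c => match c with
  | none => 0
  | some a => if a ∈ U then 1 else 0

theorem addChar'_eq_stdAddChar (p : ℕ) [NeZero p] (x : ZMod p) :
    addChar' p x = ZMod.stdAddChar x := by
  rw [ZMod.stdAddChar_apply, ZMod.toCircle_apply, addChar']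

theorem quadChar_eq_quadraticChar (p : ℕ) [Fact p.Prime] (x : ZMod p) :
    quadChar p x = quadraticChar (ZMod p) x := by
  simp only [quadChar, quadraticChar_apply, quadraticCharFun]
  congr

theorem ringChar_zmod_ne_two {p : ℕ} (hp : p % 4 = 1) : ringChar (ZMod p) ≠ 2 := by
  rw [ZMod.ringChar_zmod_n]
  omega

theorem quadraticChar_neg_one_eq_one {p : ℕ} [Fact p.Prime] (hp : p % 4 = 1) :
    quadraticChar (ZMod p) (-1) = 1 := by
  rw [quadraticChar_one_iff_isSquare (by simp), ZMod.exists_sq_eq_neg_one_iff]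
  omega

theorem quadChar_sub_comm {p : ℕ} [Fact p.Prime] (hp : p % 4 = 1) (x y : ZMod p) :
    quadChar p (x - y) = quadChar p (y - x) := by
  rw [← neg_sub y x, neg_eq_neg_one_mul, quadChar_eq_quadraticChar, quadChar_eq_quadraticChar,
    map_mul, quadraticChar_neg_one_eq_one hp, one_mul]

/-- The complex-valued quadratic character of `F_p`. -/
def complexQuadChar (p : ℕ) [Fact p.Prime] : MulChar (ZMod p) ℂ :=
  (quadraticChar (ZMod p)).ringHomComp (Int.castRingHom ℂ)

theorem complexQuadChar_apply (p : ℕ) [Fact p.Prime] (x : ZMod p) :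
    complexQuadChar p x = (quadChar p x : ℂ) := by
  simp [complexQuadChar, quadChar_eq_quadraticChar]

/-- The quadratic Gauss sum modulo `p`. -/
def quadGaussSum (p : ℕ) [Fact p.Prime] : ℂ := gaussSum (complexQuadChar p) ZMod.stdAddChar

theorem norm_quadGaussSum {p : ℕ} [Fact p.Prime] (hp : p % 4 = 1) :
    ‖quadGaussSum p‖ = Real.sqrt p := by
  have h := gaussSum_sq (χ := complexQuadChar p) (ψ := ZMod.stdAddChar)
    (by
      obtain ⟨a, ha⟩ := quadraticChar_exists_neg_one' (ringChar_zmod_ne_two hp)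
      intro h
      have := congrArg (fun χ => χ (a : ZMod p)) h
      rw [complexQuadChar_apply, quadChar_eq_quadraticChar, ha, MulChar.one_apply_coe] at this
      norm_num at this)
    ((quadraticChar_isQuadratic (ZMod p)).comp _) (ZMod.isPrimitive_stdAddChar p)
  rw [complexQuadChar_apply, quadChar_eq_quadraticChar, quadraticChar_neg_one_eq_one hp, ZMod.card] at h
  rw [← Real.sqrt_sq (norm_nonneg (quadGaussSum p)), ← norm_pow, quadGaussSum, h]
  simp

/-- Sum of an additive character over the quadratic residues. -/
theorem sum_qRes_addChar {p : ℕ} [Fact p.Prime] (h2 : ringChar (ZMod p) ≠ 2) (c : ZMod p) :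
    ∑ b : QRes p, addChar' p (b.1 * c) =
      ((if c = 0 then (p : ℂ) else 0) - 1 + quadChar p c * quadGaussSum p) / 2 := by
  have h1 : ∑ b : QRes p, addChar' p (b.1 * c) =
      ∑ b : ZMod p, if b ≠ 0 ∧ IsSquare b then addChar' p (b * c) else 0 := by
    rw [← Finset.sum_filter]
    exact (Finset.sum_subtype _ (by simp) (fun b => addChar' p (b * c))).symm
  have hb : ∀ b : ZMod p, (if b ≠ 0 ∧ IsSquare b then addChar' p (b * c) else 0) =
      (ZMod.stdAddChar (b * c) - (if b = 0 then 1 else 0) +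
        quadChar p b * ZMod.stdAddChar (b * c)) / 2 := by
    intro b
    by_cases hb : b = 0
    · simp [hb, quadChar]
    · by_cases hs : IsSquare b <;> simp [hb, hs, quadChar, addChar'_eq_stdAddChar]
  have h3 : ∑ b : ZMod p, (quadChar p b : ℂ) * ZMod.stdAddChar (b * c) =
      quadChar p c * quadGaussSum p := by
    by_cases hc : c = 0
    · have h0 : ∑ b : ZMod p, (quadChar p b : ℂ) = 0 := by
        have := quadraticChar_sum_zero h2
        simp only [← quadChar_eq_quadraticChar] at this
        exact_mod_cast this
      have hz : quadChar p 0 = 0 := if_pos rfl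
      simp [hc, h0, hz]
    · have := gaussSum_mulShift (complexQuadChar p) ZMod.stdAddChar (Units.mk0 c hc)
      rw [quadGaussSum, ← this, Units.val_mk0, complexQuadChar_apply, ← mul_assoc]
      have hsq : (quadChar p c : ℂ) * quadChar p c = 1 := by
        simp [quadChar, hc]; split_ifs <;> norm_num
      rw [hsq, one_mul, gaussSum]
      simp [AddChar.mulShift_apply, complexQuadChar_apply, mul_comm]
  rw [h1, Finset.sum_congr rfl fun b _ => hb b, ← Finset.sum_div, Finset.sum_add_distrib,
    Finset.sum_sub_distrib, h3, AddChar.sum_mulShift c (ZMod.isPrimitive_stdAddChar p)]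
  simp

/-- The Gram matrix of the columns of the Paley ETF indexed by `F_p`. -/
theorem paleyETF_gram {p : ℕ} [Fact p.Prime] (hp2 : ringChar (ZMod p) ≠ 2) (a a' : ZMod p) :
    ∑ m, PaleyETF p m (some a) * starRingEnd ℂ (PaleyETF p m (some a')) =
      (if a = a' then 1 else 0) + quadChar p (a - a') * quadGaussSum p / p := by
  have hp : (0 : ℝ) < p := by exact_mod_cast (Fact.out : p.Prime).pos
  have hpc : (p : ℂ) ≠ 0 := by exact_mod_cast hp.ne'
  have h1 : ((1 / Real.sqrt p : ℝ) : ℂ) * ((1 / Real.sqrt p : ℝ) : ℂ) = 1 / p := by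
    rw [← Complex.ofReal_mul, div_mul_div_comm, Real.mul_self_sqrt hp.le]; simp
  have h2 : ((Real.sqrt (2 / p) : ℝ) : ℂ) * ((Real.sqrt (2 / p) : ℝ) : ℂ) = 2 / p := by
    rw [← Complex.ofReal_mul, Real.mul_self_sqrt (by positivity)]; simp
  have h3 : ∀ b : QRes p, PaleyETF p (some b) (some a) *
      starRingEnd ℂ (PaleyETF p (some b) (some a')) = 2 / p * addChar' p (b.1 * (a - a')) := by
    intro b
    simp only [PaleyETF, map_mul, Complex.conj_ofReal, addChar'_eq_stdAddChar, ← h2]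
    rw [← AddChar.map_neg_eq_conj, mul_mul_mul_comm, ← AddChar.map_add_eq_mul]
    congr 2
    ring
  rw [Fintype.sum_option, Finset.sum_congr rfl fun b _ => h3 b, ← Finset.mul_sum,
    sum_qRes_addChar hp2]
  simp only [PaleyETF, Complex.conj_ofReal, h1, sub_eq_zero]
  split_ifs <;> field_simp <;> ring

/-- The bilinear form of the Paley graph. -/
def paleyForm (p : ℕ) [NeZero p] (f g : ZMod p → ℝ) : ℝ :=
  ∑ x, ∑ y, (quadChar p (x - y) : ℝ) * (f x * g y)

theorem sum_norm_sq_paleyETF {p : ℕ} [Fact p.Prime] (hp2 : ringChar (ZMod p) ≠ 2)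
    (f : ZMod p → ℝ) :
    ((∑ m, ‖∑ n : Option (ZMod p), PaleyETF p m n * n.elim 0 (fun a => (f a : ℂ))‖ ^ 2 : ℝ) : ℂ) =
      ((∑ x, f x ^ 2 : ℝ) : ℂ) + quadGaussSum p / p * (paleyForm p f f : ℂ) := by
  have h1 : ∀ m, ((‖∑ n : Option (ZMod p), PaleyETF p m n * n.elim 0 (fun a => (f a : ℂ))‖ ^ 2 : ℝ)
      : ℂ) = ∑ x, ∑ y, (f x * f y : ℂ) *
        (PaleyETF p m (some x) * starRingEnd ℂ (PaleyETF p m (some y))) := by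
    intro m
    rw [Complex.ofReal_pow, ← Complex.mul_conj', Fintype.sum_option]
    simp only [Option.elim_none, Option.elim_some, mul_zero, zero_add, map_sum, map_mul,
      Complex.conj_ofReal, Finset.sum_mul_sum]
    refine Finset.sum_congr rfl fun x _ => Finset.sum_congr rfl fun y _ => ?_
    ring
  rw [Complex.ofReal_sum, Finset.sum_congr rfl fun m _ => h1 m, Finset.sum_comm]
  simp_rw [Finset.sum_comm (s := (univ : Finset (Option (QRes p)))), ← Finset.mul_sum,
    paleyETF_gram hp2, mul_add, Finset.sum_add_distrib]
  congr 1
  · simp [sq]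
  · simp only [paleyForm, Complex.ofReal_sum, Finset.mul_sum]
    refine Finset.sum_congr rfl fun x _ => Finset.sum_congr rfl fun y _ => ?_
    push_cast
    ring

/-- The restricted isometry property bounds the Paley quadratic form on sparse vectors. -/
theorem abs_paleyForm_self_le {p : ℕ} [Fact p.Prime] (hp : p % 4 = 1) {K δ : ℝ}
    (h : HasRIP (PaleyETF p) K δ) (f : ZMod p → ℝ)
    (hf : ((univ.filter fun x => f x ≠ 0).card : ℝ) ≤ K) :
    |paleyForm p f f| ≤ Real.sqrt p * δ * ∑ x, f x ^ 2 := by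
  have hp0 : (0 : ℝ) < p := by exact_mod_cast (Fact.out : p.Prime).pos
  obtain ⟨hl, hu⟩ := h (fun n => n.elim 0 fun a => (f a : ℂ)) (by
    refine le_trans (Nat.cast_le.2 ?_) hf
    rw [← Finset.card_map (s := univ.filter fun x => f x ≠ 0) Function.Embedding.some]
    refine Finset.card_le_card (fun n hn => ?_)
    cases n <;> simp_all)
  have hs := sum_norm_sq_paleyETF (ringChar_zmod_ne_two hp) f
  set T := ∑ m, ‖∑ n : Option (ZMod p), PaleyETF p m n * n.elim 0 (fun a => (f a : ℂ))‖ ^ 2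
  have hn : ∑ n : Option (ZMod p), ‖n.elim 0 (fun a => (f a : ℂ))‖ ^ 2 = ∑ x, f x ^ 2 := by
    simp [Fintype.sum_option]
  rw [hn] at hl hu
  have hT : |T - ∑ x, f x ^ 2| = |paleyForm p f f| / Real.sqrt p := by
    have h1 : ((T - ∑ x, f x ^ 2 : ℝ) : ℂ) = quadGaussSum p / p * (paleyForm p f f : ℂ) := by
      rw [Complex.ofReal_sub, hs]; ring
    have h2 := congrArg norm h1
    rw [Complex.norm_real, norm_mul, norm_div, norm_quadGaussSum hp, Complex.norm_real,
      Complex.norm_natCast, Real.norm_eq_abs, Real.norm_eq_abs, Real.sqrt_div_self] at h2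
    rw [h2]; ring
  have hT' : |T - ∑ x, f x ^ 2| ≤ δ * ∑ x, f x ^ 2 := by
    rw [abs_le]; constructor <;> linarith
  rw [hT, div_le_iff₀ (Real.sqrt_pos.2 hp0)] at hT'
  linarith

theorem paleyForm_comm {p : ℕ} [Fact p.Prime] (hp : p % 4 = 1) (f g : ZMod p → ℝ) :
    paleyForm p f g = paleyForm p g f := by
  rw [paleyForm, Finset.sum_comm]
  refine Finset.sum_congr rfl fun x _ => Finset.sum_congr rfl fun y _ => ?_
  rw [quadChar_sub_comm hp, mul_comm (f y)]

theorem paleyForm_add_left {p : ℕ} [Fact p.Prime] (f f' g : ZMod p → ℝ) :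
    paleyForm p (f + f') g = paleyForm p f g + paleyForm p f' g := by
  simp only [paleyForm, ← Finset.sum_add_distrib, Pi.add_apply, add_mul, mul_add]

theorem paleyForm_smul_left {p : ℕ} [Fact p.Prime] (c : ℝ) (f g : ZMod p → ℝ) :
    paleyForm p (c • f) g = c * paleyForm p f g := by
  simp only [paleyForm, Finset.mul_sum, Pi.smul_apply, smul_eq_mul]
  refine Finset.sum_congr rfl fun x _ => Finset.sum_congr rfl fun y _ => ?_
  ring

/-- Polarization of a bound on the Paley quadratic form. -/
theorem abs_paleyForm_le {p : ℕ} [Fact p.Prime] (hp : p % 4 = 1) {K : ℕ} {D : ℝ}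
    (h : ∀ f : ZMod p → ℝ, (univ.filter fun x => f x ≠ 0).card ≤ 2 * K →
      |paleyForm p f f| ≤ D * ∑ x, f x ^ 2)
    (f g : ZMod p → ℝ) (hf : (univ.filter fun x => f x ≠ 0).card ≤ K)
    (hg : (univ.filter fun x => g x ≠ 0).card ≤ K) :
    2 * |paleyForm p f g| ≤ D * (∑ x, f x ^ 2 + ∑ x, g x ^ 2) := by
  have hsupp : ∀ c : ℝ, (univ.filter fun x => (f + c • g) x ≠ 0).card ≤ 2 * K := by
    intro c
    refine (Finset.card_le_card (t := (univ.filter fun x => f x ≠ 0) ∪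
      univ.filter fun x => g x ≠ 0) fun x hx => ?_).trans ((Finset.card_union_le _ _).trans
        (by omega))
    by_contra hx'
    simp at hx hx'
    simp [hx'] at hx
  have hexp : ∀ c : ℝ, paleyForm p (f + c • g) (f + c • g) =
      paleyForm p f f + 2 * c * paleyForm p f g + c ^ 2 * paleyForm p g g := by
    intro c
    have hc : ∀ u, paleyForm p u (f + c • g) = paleyForm p u f + c * paleyForm p u g := by
      intro u
      rw [paleyForm_comm hp, paleyForm_add_left, paleyForm_smul_left, paleyForm_comm hp f,
        paleyForm_comm hp g]
    rw [hc, paleyForm_comm hp _ f, paleyForm_comm hp _ g, hc, hc, paleyForm_comm hp g f]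
    ring
  have hsum : ∀ c : ℝ, ∑ x, (f + c • g) x ^ 2 =
      ∑ x, f x ^ 2 + 2 * c * ∑ x, f x * g x + c ^ 2 * ∑ x, g x ^ 2 := by
    intro c
    simp only [Finset.mul_sum, ← Finset.sum_add_distrib, Pi.add_apply, Pi.smul_apply, smul_eq_mul]
    refine Finset.sum_congr rfl fun x _ => ?_
    ring
  have h1 := abs_le.1 (h _ (hsupp 1))
  have h2 := abs_le.1 (h _ (hsupp (-1)))
  rw [hexp, hsum] at h1 h2
  have : |paleyForm p f g| ≤ D * (∑ x, f x ^ 2 + ∑ x, g x ^ 2) / 2 := by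
    rw [abs_le]; constructor <;> linarith
  linarith

theorem sum_sq_le_of_le {ι : Type*} [Fintype ι] {L : ℕ} {f : ι → ℝ} {m : ℝ}
    (h0 : ∀ x, 0 ≤ f x) (hm : ∀ x, f x ≤ m)
    (hf : (univ.filter fun x => f x ≠ 0).card ≤ L) :
    ∑ x, f x ^ 2 ≤ L * m ^ 2 := by
  rw [← Finset.sum_filter_of_ne (p := fun x => f x ≠ 0) (by simp)]
  refine (Finset.sum_le_card_nsmul _ _ (m ^ 2) fun x _ => pow_le_pow_left₀ (h0 x) (hm x) 2).trans ?_
  rw [nsmul_eq_mul]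
  gcongr

theorem abs_paleyForm_le_of_bounded {p : ℕ} [Fact p.Prime] (hp : p % 4 = 1) {L : ℕ} {D : ℝ}
    (hD : 0 ≤ D)
    (h : ∀ f : ZMod p → ℝ, (univ.filter fun x => f x ≠ 0).card ≤ 2 * L →
      |paleyForm p f f| ≤ D * ∑ x, f x ^ 2)
    {f g : ZMod p → ℝ} {m m' : ℝ} (hm : 0 < m) (hm' : 0 < m')
    (hf0 : ∀ x, 0 ≤ f x) (hfm : ∀ x, f x ≤ m) (hf : (univ.filter fun x => f x ≠ 0).card ≤ L)
    (hg0 : ∀ x, 0 ≤ g x) (hgm : ∀ x, g x ≤ m') (hg : (univ.filter fun x => g x ≠ 0).card ≤ L) :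
    |paleyForm p f g| ≤ D * L * (m * m') := by
  have h1 := abs_paleyForm_le hp h (m' • f) (m • g) (by simpa [hm'.ne'] using hf)
    (by simpa [hm.ne'] using hg)
  rw [paleyForm_smul_left, paleyForm_comm hp, paleyForm_smul_left, paleyForm_comm hp, ← mul_assoc,
    abs_mul, abs_of_pos (by positivity)] at h1
  simp only [Pi.smul_apply, smul_eq_mul, mul_pow, ← Finset.mul_sum] at h1
  have h2 : m' ^ 2 * ∑ x, f x ^ 2 + m ^ 2 * ∑ x, g x ^ 2 ≤ 2 * (L * (m * m') ^ 2) := by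
    have := mul_le_mul_of_nonneg_left (sum_sq_le_of_le hf0 hfm hf) (sq_nonneg m')
    have := mul_le_mul_of_nonneg_left (sum_sq_le_of_le hg0 hgm hg) (sq_nonneg m)
    linarith
  have h3 := mul_le_mul_of_nonneg_left h2 hD
  have hmm : 0 < m * m' := by positivity
  refine le_of_mul_le_mul_left ?_ hmm
  linarith

/-- Every finite set contains a subset of prescribed size on which a function takes its largest
values. -/
theorem exists_subset_card_eq_forall_le {ι : Type*} (f : ι → ℝ) (S : Finset ι) (L : ℕ)
    (hL : L ≤ S.card) :
    ∃ T ⊆ S, T.card = L ∧ ∀ a ∈ T, ∀ b ∈ S \ T, f b ≤ f a := by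
  induction L with
  | zero => exact ⟨∅, by simp⟩
  | succ L ih =>
    obtain ⟨T, hTS, hT, h⟩ := ih (by omega)
    have hne : (S \ T).Nonempty := by
      rw [← Finset.card_pos, Finset.card_sdiff_of_subset hTS]; omega
    obtain ⟨c, hc, hmax⟩ := Finset.exists_max_image (S \ T) f hne
    rw [Finset.mem_sdiff] at hc
    refine ⟨insert c T, Finset.insert_subset hc.1 hTS, by simp [hc.2, hT], fun a ha b hb => ?_⟩
    have hb' : b ∈ S \ T := by simp at hb ⊢; tauto
    rcases Finset.mem_insert.1 ha with rfl | ha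
    · exact hmax b hb'
    · exact h a ha b hb'

/-- A subadditive functional bounded by `A * m` on `L`-sparse functions with values in `[0, m]`
is bounded by `A * (m + ‖f‖₁ / L)` on all functions with values in `[0, m]`. -/
theorem le_of_le_on_sparse {ι : Type*} [Fintype ι] {N : (ι → ℝ) → ℝ} {A : ℝ} {L : ℕ}
    (hA : 0 ≤ A) (hL : 0 < L) (hadd : ∀ f g, N (f + g) ≤ N f + N g)
    (hN : ∀ f : ι → ℝ, ∀ m : ℝ, 0 < m → (∀ x, 0 ≤ f x) → (∀ x, f x ≤ m) →
      (univ.filter fun x => f x ≠ 0).card ≤ L → N f ≤ A * m)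
    (f : ι → ℝ) {m : ℝ} (hm : 0 < m) (h0 : ∀ x, 0 ≤ f x) (hfm : ∀ x, f x ≤ m) :
    N f ≤ A * (m + (∑ x, f x) / L) := by
  induction hn : (univ.filter fun x => f x ≠ 0).card using Nat.strong_induction_on
    generalizing f m with
  | _ n ih =>
  have hLR : (0 : ℝ) < L := by exact_mod_cast hL
  by_cases hsparse : n ≤ L
  · refine (hN f m hm h0 hfm (hn ▸ hsparse)).trans (mul_le_mul_of_nonneg_left ?_ hA)
    have := Finset.sum_nonneg fun x (_ : x ∈ univ) => h0 x
    have : 0 ≤ (∑ x, f x) / L := by positivity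
    linarith
  obtain ⟨T, hTS, hT, hle⟩ := exists_subset_card_eq_forall_le f
    (univ.filter fun x => f x ≠ 0) L (by omega)
  have hTne : T.Nonempty := by rw [← Finset.card_pos]; omega
  obtain ⟨t, ht, htmin⟩ := Finset.exists_min_image T f hTne
  have htpos : 0 < f t := lt_of_le_of_ne (h0 t) (by simpa [eq_comm] using hTS ht)
  set f₁ : ι → ℝ := fun x => if x ∈ T then f x else 0 with hf₁
  set f₂ : ι → ℝ := fun x => if x ∈ T then 0 else f x with hf₂
  have hsplit : f = f₁ + f₂ := by
    ext x; by_cases hx : x ∈ T <;> simp [hf₁, hf₂, hx]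
  have hs₂ : (univ.filter fun x => f₂ x ≠ 0) = (univ.filter fun x => f x ≠ 0) \ T := by
    ext x; by_cases hx : x ∈ T <;> simp [hf₂, hx]
  have h₁ : N f₁ ≤ A * m := by
    refine hN f₁ m hm (fun x => ?_) (fun x => ?_) ?_
    · simp only [hf₁]; split_ifs <;> simp [h0]
    · simp only [hf₁]; split_ifs <;> simp [hfm, hm.le]
    · rw [← hT]
      refine Finset.card_le_card fun x hx => ?_
      by_contra hxT
      simp [hf₁, hxT] at hx
  have h₂ : N f₂ ≤ A * (f t + (∑ x, f₂ x) / L) := by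
    refine ih (n - L) (by omega) f₂ htpos (fun x => ?_) (fun x => ?_) ?_
    · simp only [hf₂]; split_ifs <;> simp [h0]
    · by_cases hx : x ∈ T
      · simp [hf₂, hx, htpos.le]
      · by_cases hx0 : f x = 0
        · simp [hf₂, hx0, htpos.le]
        · simpa [hf₂, hx] using hle t ht x (by simp [hx, hx0])
    · rw [hs₂, Finset.card_sdiff_of_subset hTS, hn, hT]
  have hsum₁ : L * f t ≤ ∑ x, f₁ x := by
    have := Finset.card_nsmul_le_sum T f (f t) htmin
    simpa [hf₁, hT, Finset.sum_ite_mem] using this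
  have hsum : ∑ x, f x = ∑ x, f₁ x + ∑ x, f₂ x := by
    rw [← Finset.sum_add_distrib]; exact Finset.sum_congr rfl fun x _ => congrFun hsplit x
  have hNf : N f ≤ N f₁ + N f₂ := by
    conv_lhs => rw [hsplit]
    exact hadd _ _
  calc N f ≤ N f₁ + N f₂ := hNf
    _ ≤ A * m + A * (f t + (∑ x, f₂ x) / L) := add_le_add h₁ h₂
    _ = A * (m + (f t + (∑ x, f₂ x) / L)) := by ring
    _ ≤ A * (m + (∑ x, f x) / L) := by
      refine mul_le_mul_of_nonneg_left ?_ hA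
      rw [hsum, add_div]
      have : f t ≤ (∑ x, f₁ x) / L := by rw [le_div_iff₀ hLR]; linarith
      linarith

/-- Bound on the Paley form of two bounded probability vectors. -/
theorem abs_paleyForm_le_of_prob {p : ℕ} [Fact p.Prime] (hp : p % 4 = 1) {L : ℕ} (hL : 0 < L)
    {D : ℝ} (hD : 0 ≤ D)
    (h : ∀ f : ZMod p → ℝ, (univ.filter fun x => f x ≠ 0).card ≤ 2 * L →
      |paleyForm p f f| ≤ D * ∑ x, f x ^ 2)
    {μ ν : ZMod p → ℝ} {m : ℝ} (hm : 0 < m) (hμ0 : ∀ x, 0 ≤ μ x) (hν0 : ∀ x, 0 ≤ ν x)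
    (hμ1 : ∑ x, μ x = 1) (hν1 : ∑ x, ν x = 1) (hμm : ∀ x, μ x ≤ m) (hνm : ∀ x, ν x ≤ m) :
    |paleyForm p μ ν| ≤ D * L * (m + 1 / L) ^ 2 := by
  have hsub : ∀ f f' g : ZMod p → ℝ,
      |paleyForm p (f + f') g| ≤ |paleyForm p f g| + |paleyForm p f' g| := by
    intro f f' g
    rw [paleyForm_add_left]
    exact abs_add_le _ _
  have hgen : ∀ g : ZMod p → ℝ, ∀ m', 0 < m' → (∀ x, 0 ≤ g x) → (∀ x, g x ≤ m') →
      (univ.filter fun x => g x ≠ 0).card ≤ L →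
      |paleyForm p g μ| ≤ D * L * (m + 1 / L) * m' := by
    intro g m' hm' hg0 hgm hg
    have := le_of_le_on_sparse (N := fun f => |paleyForm p f g|) (A := D * L * m')
      (by positivity) hL (fun f f' => hsub f f' g)
      (fun f k hk hf0 hfk hf => by
        have := abs_paleyForm_le_of_bounded hp hD h hk hm' hf0 hfk hf hg0 hgm hg
        simpa only [mul_assoc, mul_comm k m'] using this)
      μ hm hμ0 hμm
    rw [paleyForm_comm hp]
    rw [hμ1] at this
    linarith
  have := le_of_le_on_sparse (N := fun g => |paleyForm p g μ|) (A := D * L * (m + 1 / L))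
    (by positivity) hL (fun f f' => hsub f f' μ) hgen ν hm hν0 hνm
  rw [hν1] at this
  rw [paleyForm_comm hp]
  linarith

/-- The success probability of the Paley extractor in terms of the Paley form. -/
theorem paleyExt_prob {p : ℕ} [Fact p.Prime] {μ ν : ZMod p → ℝ}
    (hμ1 : ∑ x, μ x = 1) (hν1 : ∑ x, ν x = 1) :
    (∑ x : ZMod p, ∑ y : ZMod p, μ x * ν y * (if paleyExt p x y = 1 then (1 : ℝ) else 0)) - 1 / 2 =
      (paleyForm p μ ν + ∑ x, μ x * ν x) / 2 := by
  have h1 : ∀ x y : ZMod p, μ x * ν y * (if paleyExt p x y = 1 then (1 : ℝ) else 0) =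
      (μ x * ν y + (quadChar p (x - y) : ℝ) * (μ x * ν y) +
        (if x = y then μ x * ν y else 0)) / 2 := by
    intro x y
    by_cases hxy : x = y
    · simp [hxy, paleyExt, quadChar]
    · by_cases hs : IsSquare (x - y) <;> simp [hxy, hs, paleyExt, quadChar, sub_eq_zero]
  simp_rw [h1, ← Finset.sum_div, Finset.sum_add_distrib, ← Finset.sum_mul_sum, hμ1, hν1]
  simp [paleyForm]
  ring

/-- Polylogarithmic factors are absorbed by a small power. -/
theorem exists_forall_log_sq_mul_rpow_le (c : ℝ) {α : ℝ} (hα : 0 < α) :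
    ∃ n₀ : ℕ, ∀ n : ℕ, n₀ ≤ n →
      c * (n : ℝ) ^ (-(α / 2)) * Real.log n ^ 2 + (n : ℝ) ^ (-α) ≤ (n : ℝ) ^ (-(α / 4)) := by
  have h1 : Filter.Tendsto (fun x : ℝ => c * (Real.log x ^ (2 : ℝ) / x ^ (α / 4)) + x ^ (-(3 * α / 4)))
      Filter.atTop (nhds (c * 0 + 0)) :=
    ((isLittleO_log_rpow_rpow_atTop 2 (by positivity)).tendsto_div_nhds_zero.const_mul c).add
      (tendsto_rpow_neg_atTop (by positivity))
  rw [mul_zero, add_zero] at h1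
  have h2 := (h1.comp tendsto_natCast_atTop_atTop).eventually (gt_mem_nhds one_pos)
  obtain ⟨n₀, hn₀⟩ := Filter.eventually_atTop.1 h2
  refine ⟨max n₀ 1, fun n hn => ?_⟩
  have hn0 : (0 : ℝ) < n := by
    have : 1 ≤ n := le_trans (le_max_right _ _) hn
    exact_mod_cast this
  have h3 := mul_le_mul_of_nonneg_right (hn₀ n (le_trans (le_max_left _ _) hn)).le
    (Real.rpow_nonneg hn0.le (-(α / 4)))
  refine le_trans (le_of_eq ?_) (h3.trans_eq (one_mul _))
  simp only [Function.comp_apply, Real.rpow_two]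
  have e1 : -(α / 2) = -(α / 4) + -(α / 4) := by ring
  have e2 : -α = -(3 * α / 4) + -(α / 4) := by ring
  rw [e1, e2, Real.rpow_add hn0, Real.rpow_add hn0, Real.rpow_neg hn0.le (α / 4)]
  ring

/-- **Corollary 14 (second main result): the conjectured RIP constant implies the
Chor–Goldreich conjecture.** Suppose there is `C > 0` such that for every prime
`p ≡ 1 (mod 4)` and every `2 ≤ K ≤ p + 1`, the Paley ETF has the
`(K, C·√(K/p)·log K·log p)`-RIP. Then for every `0 < α < 1/2` there are `β > 0` and `p₀`
such that for all primes `p ≥ p₀` with `p ≡ 1 (mod 4)`, the Paley graph extractor is a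
2-source `(α·n, p^{−β})`-extractor: for any two independent sources on `F_p` with
min-entropy at least `α·n`, `n = ⌈log₂ p⌉`, its bias satisfies
`|Pr[Ext_p(X,Y) = 1] − 1/2| ≤ p^{−β}`. Sources are modelled as probability mass
functions, and `Pr[Ext_p(X,Y) = 1] = ∑_{x,y} μ(x)·ν(y)·[Ext_p(x,y) = 1]`. -/
theorem paley_rip_conjecture_implies_extractor
    (h : ∃ C : ℝ, 0 < C ∧ ∀ (p : ℕ) [Fact p.Prime], p % 4 = 1 →
      ∀ K : ℕ, 2 ≤ K → K ≤ p + 1 →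
        HasRIP (PaleyETF p) (K : ℝ)
          (C * Real.sqrt ((K : ℝ) / (p : ℝ)) * Real.log K * Real.log p)) :
    ∀ α : ℝ, 0 < α → α < 1 / 2 →
      ∃ β : ℝ, 0 < β ∧ ∃ p₀ : ℕ,
        ∀ (p : ℕ) [Fact p.Prime], p % 4 = 1 → p₀ ≤ p →
          ∀ μ ν : ZMod p → ℝ,
            (∀ x, 0 ≤ μ x) → (∀ x, 0 ≤ ν x) →
            (∑ x : ZMod p, μ x = 1) → (∑ x : ZMod p, ν x = 1) →
            (∀ x, μ x ≤ (2 : ℝ) ^ (-(α * (Nat.clog 2 p : ℝ)))) →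
            (∀ x, ν x ≤ (2 : ℝ) ^ (-(α * (Nat.clog 2 p : ℝ)))) →
            |(∑ x : ZMod p, ∑ y : ZMod p,
                μ x * ν y * (if paleyExt p x y = 1 then (1 : ℝ) else 0)) - 1 / 2| ≤
              (p : ℝ) ^ (-β) := by

  obtain ⟨C, hC, h⟩ := h
  intro α hα hα2
  obtain ⟨n₀, hn₀⟩ := exists_forall_log_sq_mul_rpow_le (8 * C) hα
  refine ⟨α / 4, by positivity, max n₀ 16, fun p _ hp hpn μ ν hμ0 hν0 hμ1 hν1 hμm hνm => ?_⟩
  have hp16 : (16 : ℝ) ≤ p := by exact_mod_cast (le_max_right _ _).trans hpn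
  have hp0 : (0 : ℝ) < p := by linarith
  set P : ℝ := (p : ℝ) ^ α with hP
  have hP1 : 1 ≤ P := Real.one_le_rpow (by linarith) hα.le
  have hP0 : 0 < P := by linarith
  have hinv : (p : ℝ) ^ (-α) = P⁻¹ := Real.rpow_neg hp0.le α
  have hmin : (2 : ℝ) ^ (-(α * (Nat.clog 2 p : ℝ))) ≤ P⁻¹ := by
    rw [Real.rpow_neg (by norm_num), mul_comm, Real.rpow_mul (by norm_num), Real.rpow_natCast]
    have : (p : ℝ) ≤ 2 ^ Nat.clog 2 p := by exact_mod_cast Nat.le_pow_clog (by norm_num) p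
    exact inv_anti₀ hP0 (Real.rpow_le_rpow hp0.le this hα.le)
  replace hμm := fun x => (hμm x).trans hmin
  replace hνm := fun x => (hνm x).trans hmin
  set L : ℕ := ⌈P⌉₊ with hL
  have hL0 : 0 < L := Nat.ceil_pos.2 hP0
  have hPL : P ≤ L := Nat.le_ceil P
  have hLP : (L : ℝ) ≤ 2 * P := by linarith [Nat.ceil_lt_add_one hP0.le]
  have hsqrt : P ≤ Real.sqrt p := by
    rw [Real.sqrt_eq_rpow]
    exact Real.rpow_le_rpow_of_exponent_le (by linarith) hα2.le
  have h4 : 4 ≤ Real.sqrt p := Real.le_sqrt_of_sq_le (by linarith)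
  have h2L : (2 * L : ℝ) ≤ p := by nlinarith [Real.mul_self_sqrt hp0.le]
  have h2L' : 2 * L ≤ p := by exact_mod_cast h2L
  have hlog : 0 ≤ Real.log p := Real.log_nonneg (by linarith)
  set Q : ℝ := (p : ℝ) ^ (α / 2) with hQ
  have hQ0 : 0 < Q := Real.rpow_pos_of_pos hp0 _
  have hQQ : Q * Q = P := by rw [hQ, ← Real.rpow_add hp0, add_halves]
  set D : ℝ := 2 * C * Q * Real.log p ^ 2 with hD
  have hD0 : 0 ≤ D := by positivity
  have hform : ∀ f : ZMod p → ℝ, (univ.filter fun x => f x ≠ 0).card ≤ 2 * L →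
      |paleyForm p f f| ≤ D * ∑ x, f x ^ 2 := by
    intro f hf
    refine (abs_paleyForm_self_le hp (h p hp (2 * L) (by omega) (by omega)) f
      (by exact_mod_cast hf)).trans ?_
    refine mul_le_mul_of_nonneg_right ?_ (Finset.sum_nonneg fun x _ => sq_nonneg _)
    push_cast
    have hs : Real.sqrt p * Real.sqrt (2 * L / p) ≤ 2 * Q := by
      rw [← Real.sqrt_mul hp0.le, mul_div_cancel₀ _ hp0.ne']
      exact Real.sqrt_le_iff.2 ⟨by positivity, by nlinarith⟩
    have hl : Real.log (2 * L) ≤ Real.log p := Real.log_le_log (by positivity) h2L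
    calc Real.sqrt p * (C * Real.sqrt (2 * L / p) * Real.log (2 * L) * Real.log p)
        = C * (Real.sqrt p * Real.sqrt (2 * L / p)) * Real.log (2 * L) * Real.log p := by ring
      _ ≤ C * (2 * Q) * Real.log p * Real.log p := by
          have : 0 ≤ Real.log (2 * L) := Real.log_nonneg (by
            have : (1 : ℝ) ≤ L := by exact_mod_cast hL0
            linarith)
          gcongr
      _ = D := by rw [hD]; ring
  have hB := abs_paleyForm_le_of_prob hp hL0 hD0 hform (inv_pos.2 hP0) hμ0 hν0 hμ1 hν1 hμm hνm
  have hB' : |paleyForm p μ ν| ≤ 8 * D * P⁻¹ := by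
    refine hB.trans ?_
    have : P⁻¹ + 1 / L ≤ 2 * P⁻¹ := by
      have : 1 / (L : ℝ) ≤ P⁻¹ := by rw [one_div]; gcongr
      linarith
    calc D * L * (P⁻¹ + 1 / L) ^ 2 ≤ D * (2 * P) * (2 * P⁻¹) ^ 2 := by gcongr
      _ = 8 * D * P⁻¹ := by field_simp; ring
  have hdiag0 : 0 ≤ ∑ x, μ x * ν x := Finset.sum_nonneg fun x _ => mul_nonneg (hμ0 x) (hν0 x)
  have hdiag : ∑ x, μ x * ν x ≤ P⁻¹ := by
    calc ∑ x, μ x * ν x ≤ ∑ x, μ x * P⁻¹ :=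
          Finset.sum_le_sum fun x _ => mul_le_mul_of_nonneg_left (hνm x) (hμ0 x)
      _ = P⁻¹ := by rw [← Finset.sum_mul, hμ1, one_mul]
  rw [paleyExt_prob hμ1 hν1, abs_div, abs_two]
  have hfin := hn₀ p ((le_max_left _ _).trans hpn)
  have hQinv : (p : ℝ) ^ (-(α / 2)) = Q * P⁻¹ := by
    rw [Real.rpow_neg hp0.le, ← hQ, ← hQQ]; field_simp
  rw [hinv, hQinv] at hfin
  have habs := abs_add_le (paleyForm p μ ν) (∑ x, μ x * ν x)
  rw [abs_of_nonneg hdiag0] at habs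
  have hP' : 0 < P⁻¹ := inv_pos.2 hP0
  rw [hD] at hB'
  linarith
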